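/- Every row of the hyperbolic Pascal triangle {4,5} is vertically symmetric: for each n ≥ 0 and each 0 ≤ k < s_n, the value of the k-th vertex of row n equals the value of the (s_n − 1 − k)-th vertex, and the k-th vertex has type A if and only if the (s_n − 1 − k)-th vertex has type A (winger vertices being counted as type B). -/

import Mathlib

/-- Type of a vertex in a hyperbolic Pascal triangle: winger, A, or B. -/
inductive HVType where
  | W : HVType
  | A : HVType
  | B : HVType
deriving DecidableEq, Repr

/-- Number of type-B children produced by a vertex of the given type
in the hyperbolic Pascal triangle `{4,q}`. -/
def hBCount (q : ℕ) : HVType → ℕ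
  | .A => q - 4
  | .B => q - 3
  | .W => 0

/-- The inner part of the next row: for each pair of consecutive vertices a shared
type-A child whose value is the sum of the parents' values, followed by the
type-B copies of the right parent. -/
def hMid (q : ℕ) : List (HVType × ℕ) → List (HVType × ℕ)
  | a :: b :: rest =>
      (HVType.A, a.2 + b.2) ::
        (List.replicate (hBCount q b.1) (HVType.B, b.2) ++ hMid q (b :: rest))
  | _ => []

/-- Row `n` of the hyperbolic Pascal triangle `{4,q}`, as a list of
(type, value) pairs read from left to right. -/
def hRow (q : ℕ) : ℕ → List (HVType × ℕ)
  | 0 => [(HVType.W, 1)]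
  | n + 1 => (HVType.W, 1) :: (hMid q (hRow q n) ++ [(HVType.W, 1)])

/-- Number of type-A vertices of row `n`. -/
def hCountA (q n : ℕ) : ℕ := ((hRow q n).filter (fun v => v.1 = HVType.A)).length

/-- Number of type-B vertices of row `n`. -/
def hCountB (q n : ℕ) : ℕ := ((hRow q n).filter (fun v => v.1 = HVType.B)).length

/-- Sum of the values of the type-A vertices of row `n`. -/
def hSumA (q n : ℕ) : ℕ :=
  (((hRow q n).filter (fun v => v.1 = HVType.A)).map Prod.snd).sum

/-- Sum of the values of the type-B vertices of row `n`. -/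
def hSumB (q n : ℕ) : ℕ :=
  (((hRow q n).filter (fun v => v.1 = HVType.B)).map Prod.snd).sum

/-- The number `s_n` of vertices of row `n`. -/
def hLen (q n : ℕ) : ℕ := (hRow q n).length

/-- The value of the `k`-th (0-indexed) vertex of row `n`. -/
def hVal (q n k : ℕ) : ℕ := ((hRow q n).getD k (HVType.W, 0)).2

/-- The type of the `k`-th (0-indexed) vertex of row `n`. -/
def hType (q n k : ℕ) : HVType := ((hRow q n).getD k (HVType.W, 0)).1

theorem hMid_append_pair (q : ℕ) (l : List (HVType × ℕ)) (x y : HVType × ℕ) :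
    hMid q (l ++ [x, y]) =
      hMid q (l ++ [x]) ++
        (HVType.A, x.2 + y.2) :: List.replicate (hBCount q y.1) (HVType.B, y.2) := by
  induction l with
  | nil => simp [hMid]
  | cons a l ih => cases l <;> simp_all [hMid]

theorem hMid_reverse (q : ℕ) (l : List (HVType × ℕ)) (a z : HVType × ℕ) :
    List.replicate (hBCount q z.1) (HVType.B, z.2) ++ hMid q (z :: (l.reverse ++ [a])) =
      (hMid q (a :: (l ++ [z]))).reverse ++
        List.replicate (hBCount q a.1) (HVType.B, a.2) := by
  induction l generalizing a with
  | nil => simp [hMid, add_comm]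
  | cons b l ih =>
    have h := hMid_append_pair q (z :: l.reverse) b a
    have ih' := ih b
    simp only [List.cons_append] at h ih'
    simp only [List.reverse_cons, List.append_assoc, List.cons_append, List.nil_append]
    rw [h, ← List.append_assoc, ih']
    simp [hMid, add_comm]

theorem hRow_reverse (q n : ℕ) : (hRow q n).reverse = hRow q n := by
  induction n with
  | zero => rfl
  | succ n ih =>
    suffices h : (hMid q (hRow q n)).reverse = hMid q (hRow q n) by simp [hRow, h]
    cases n with
    | zero => rfl
    | succ m =>
      have hm : (hMid q (hRow q m)).reverse = hMid q (hRow q m) := by simpa [hRow] using ih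
      have h := hMid_reverse q (hMid q (hRow q m)) (HVType.W, 1) (HVType.W, 1)
      simpa [hRow, hm, hBCount] using h.symm

theorem hRow_getD_symm (q n k : ℕ) (hk : k < hLen q n) (d : HVType × ℕ) :
    (hRow q n).getD (hLen q n - 1 - k) d = (hRow q n).getD k d := by
  have h := List.getElem?_reverse (l := hRow q n) (i := k) hk
  rw [hRow_reverse] at h
  simp only [List.getD_eq_getElem?_getD, h, hLen]

/-- every row of the hyperbolic Pascal triangle `{4,5}` is vertically
symmetric: the `k`-th and `(s_n - 1 - k)`-th vertices of row `n` have equal values,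
and one has type A iff the other does (wingers counted as type B). -/
theorem stmt_15 (n k : ℕ) (hk : k < hLen 5 n) :
    hVal 5 n (hLen 5 n - 1 - k) = hVal 5 n k ∧
    (hType 5 n k = HVType.A ↔ hType 5 n (hLen 5 n - 1 - k) = HVType.A) := by
  simp only [hVal, hType, hRow_getD_symm 5 n k hk, and_self]
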